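/- Let n ∈ ℕ, P = {0, 1, …, n}, P⁺ = P ∪ {∞}, fix positive integer weights a, b, let ε ∈ ℕ, and let Λ = Λ_ε be the maximal translation of height ε. Let A and B be convex representations of P over a field K such that AΛ ≠ 0, BΛ ≠ 0, and there exists a nonzero morphism of representations from A to B. Then there exists a nonzero morphism of representations from AΛ to BΛ. -/

import Mathlib

namespace GPM

/-- A translation on a preorder: a monotone map `Λ` with `x ≤ Λ x` for all `x`. -/
structure Translation (Q : Type*) [Preorder Q] where
  toFun : Q → Q
  mono : Monotone toFun
  le_apply : ∀ x, x ≤ toFun x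

/-- A representation of a poset `P` with values in `K`-vector spaces. -/
structure Rep (P : Type*) [Preorder P] (K : Type*) [Field K] where
  V : P → Type*
  [addCommGroup : ∀ p, AddCommGroup (V p)]
  [module : ∀ p, Module K (V p)]
  map : ∀ {p q : P}, p ≤ q → V p →ₗ[K] V q
  map_refl : ∀ p : P, map (le_refl p) = LinearMap.id
  map_comp : ∀ {p q r : P} (hpq : p ≤ q) (hqr : q ≤ r),
      (map hqr).comp (map hpq) = map (hpq.trans hqr)

attribute [instance] Rep.addCommGroup Rep.module

/-- A morphism of representations (a natural transformation). -/
structure RepHom {P : Type*} [Preorder P] {K : Type*} [Field K] (M N : Rep P K) where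
  app : ∀ p, M.V p →ₗ[K] N.V p
  natural : ∀ {p q : P} (h : p ≤ q), (N.map h).comp (app p) = (app q).comp (M.map h)

/-- The shift `MΛ : p ↦ M(Λ p)` of a representation by a translation. -/
def Rep.shift {P : Type*} [Preorder P] {K : Type*} [Field K]
    (M : Rep P K) (Λ : Translation P) : Rep P K where
  V p := M.V (Λ.toFun p)
  map h := M.map (Λ.mono h)
  map_refl p := M.map_refl (Λ.toFun p)
  map_comp h1 h2 := M.map_comp (Λ.mono h1) (Λ.mono h2)

/-- The submodule of `K` underlying the convex representation of `S` at the point `p`: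
all of `K` on `S`, and `0` off `S`. -/
noncomputable def convexSub (K : Type*) [Field K] {Q : Type*} (S : Set Q) (p : Q) :
    Submodule K K :=
  @ite _ (p ∈ S) (Classical.dec _) ⊤ ⊥

theorem convexSub_pos (K : Type*) [Field K] {Q : Type*} {S : Set Q} {p : Q} (h : p ∈ S) :
    convexSub K S p = ⊤ := by
  rw [convexSub, if_pos h]

theorem convexSub_neg (K : Type*) [Field K] {Q : Type*} {S : Set Q} {p : Q} (h : p ∉ S) :
    convexSub K S p = ⊥ := by
  rw [convexSub, if_neg h]

/-- The canonical map between the fibers of the convex representations of `S` and `T`: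
the identity of `K` when both fibers are `K`, and zero otherwise. -/
noncomputable def phiMap (K : Type*) [Field K] {Q : Type*} (S T : Set Q) (p q : Q) :
    ↥(convexSub K S p) →ₗ[K] ↥(convexSub K T q) :=
  @dite _ (p ∈ S ∧ q ∈ T) (Classical.dec _)
    (fun h => Submodule.inclusion (le_of_eq (by rw [convexSub_pos K h.1, convexSub_pos K h.2])))
    (fun _ => 0)

theorem phiMap_neg (K : Type*) [Field K] {Q : Type*} {S T : Set Q} {p q : Q}
    (h : ¬(p ∈ S ∧ q ∈ T)) : phiMap K S T p q = 0 := by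
  rw [phiMap, dif_neg h]

/-- The convex representation with support the interval-convex set `S`:
`K` at points of `S`, `0` elsewhere, with identity structure maps inside `S`. -/
noncomputable def convexRep (K : Type*) [Field K] {Q : Type*} [Preorder Q]
    (S : Set Q) (hS : S.OrdConnected) : Rep Q K where
  V p := ↥(convexSub K S p)
  map {p q} _ := phiMap K S S p q
  map_refl p := by
    show phiMap K S S p p = LinearMap.id
    by_cases hp : p ∈ S
    · rw [phiMap, dif_pos ⟨hp, hp⟩]
      rfl
    · rw [phiMap_neg (K := K) (by tauto)]
      apply LinearMap.ext
      intro x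
      have hx : x = 0 := by
        apply Subtype.ext
        have hle : convexSub K S p ≤ ⊥ := le_of_eq (convexSub_neg K hp)
        simpa using hle x.2
      simp [hx]
  map_comp {p q r} hpq hqr := by
    show (phiMap K S S q r).comp (phiMap K S S p q) = phiMap K S S p r
    by_cases hp : p ∈ S
    · by_cases hr : r ∈ S
      · have hq : q ∈ S := hS.out hp hr ⟨hpq, hqr⟩
        rw [phiMap, phiMap, phiMap, dif_pos ⟨hq, hr⟩, dif_pos ⟨hp, hq⟩, dif_pos ⟨hp, hr⟩]
        rfl
      · rw [phiMap_neg (K := K) (S := S) (T := S) (p := q) (q := r) (by tauto),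
          phiMap_neg (K := K) (S := S) (T := S) (p := p) (q := r) (by tauto)]
        simp
    · rw [phiMap_neg (K := K) (S := S) (T := S) (p := p) (q := q) (by tauto),
        phiMap_neg (K := K) (S := S) (T := S) (p := p) (q := r) (by tauto)]
      simp

/-- The maximal translation `Λ_ε` of height `ε` on `P⁺ = {0, …, n} ∪ {∞}`,
for the weights `(a, b)`:  `Λ_ε ∞ = ∞`, and for `x ∈ P`, `Λ_ε x = ∞` if
`a(n−x)+b ≤ ε` and `Λ_ε x = min n (x + ⌊ε/a⌋)` otherwise. -/
def lamFun (n a b ε : ℕ) : WithTop (Fin (n + 1)) → WithTop (Fin (n + 1)) :=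
  WithTop.recTopCoe ⊤ fun x =>
    if a * (n - (x : ℕ)) + b ≤ ε then ⊤
    else (↑(⟨min n ((x : ℕ) + ε / a), by omega⟩ : Fin (n + 1)) : WithTop (Fin (n + 1)))

theorem lamFun_coe (n a b ε : ℕ) (x : Fin (n + 1)) :
    lamFun n a b ε (↑x) =
      if a * (n - (x : ℕ)) + b ≤ ε then ⊤
      else (↑(⟨min n ((x : ℕ) + ε / a), by omega⟩ : Fin (n + 1)) : WithTop (Fin (n + 1))) := rfl

theorem lamFun_le (n a b ε : ℕ) : ∀ x, x ≤ lamFun n a b ε x := by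
  intro x
  induction x using WithTop.recTopCoe with
  | top => exact le_refl _
  | coe x =>
      rw [lamFun_coe]
      by_cases h : a * (n - (x : ℕ)) + b ≤ ε
      · rw [if_pos h]
        exact le_top
      · rw [if_neg h]
        apply WithTop.coe_le_coe.mpr
        rw [Fin.le_def]
        have hx : (x : ℕ) < n + 1 := x.2
        exact le_min (Nat.le_of_lt_succ hx) (Nat.le_add_right _ _)

theorem lamFun_mono (n a b ε : ℕ) : Monotone (lamFun n a b ε) := by
  intro x y hxy
  induction x using WithTop.recTopCoe with
  | top =>
      have : y = ⊤ := top_le_iff.mp hxy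
      subst this
      exact le_refl _
  | coe x =>
      induction y using WithTop.recTopCoe with
      | top => exact le_top
      | coe y =>
          have hxy' : (x : ℕ) ≤ (y : ℕ) := by exact_mod_cast WithTop.coe_le_coe.mp hxy
          rw [lamFun_coe, lamFun_coe]
          by_cases h2 : a * (n - (y : ℕ)) + b ≤ ε
          · rw [if_pos h2]
            exact le_top
          · have h1 : ¬ a * (n - (x : ℕ)) + b ≤ ε := by
              intro h1
              apply h2
              calc a * (n - (y : ℕ)) + b ≤ a * (n - (x : ℕ)) + b := by
                    gcongr
                _ ≤ ε := h1
            rw [if_neg h1, if_neg h2]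
            apply WithTop.coe_le_coe.mpr
            rw [Fin.le_def]
            exact min_le_min (le_refl n) (Nat.add_le_add_right hxy' _)

/-- The maximal translation of height `ε` packaged as a `Translation`. -/
def lamTrans (n a b ε : ℕ) : Translation (WithTop (Fin (n + 1))) :=
  ⟨lamFun n a b ε, lamFun_mono n a b ε, lamFun_le n a b ε⟩

/-- The convex representation of `{0, …, n}` with support the interval `[x, X]`,
regarded as a representation of `P⁺` which is zero at `∞`. -/
noncomputable def intervalRep (n : ℕ) (K : Type*) [Field K] (x X : Fin (n + 1)) :
    Rep (WithTop (Fin (n + 1))) K :=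
  convexRep K (Set.Icc (↑x) (↑X)) Set.ordConnected_Icc

/-- The shift of a morphism of representations by a translation. -/
def RepHom.shift {P : Type*} [Preorder P] {K : Type*} [Field K] {M N : Rep P K}
    (f : RepHom M N) (Λ : Translation P) : RepHom (M.shift Λ) (N.shift Λ) where
  app p := f.app (Λ.toFun p)
  natural h := f.natural (Λ.mono h)

section Convex

variable {K : Type*} [Field K] {Q : Type*}

theorem subsingleton_convexSub {S : Set Q} {p : Q} (h : p ∉ S) :
    Subsingleton (convexSub K S p) := by
  rw [convexSub_neg K h]
  infer_instance

theorem coe_phiMap {S T : Set Q} {p q : Q} (hp : p ∈ S) (hq : q ∈ T) (v : convexSub K S p) :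
    (phiMap K S T p q v : K) = v := by
  rw [phiMap, dif_pos ⟨hp, hq⟩]
  rfl

theorem phiMap_injective {S T : Set Q} {p q : Q} (hp : p ∈ S) (hq : q ∈ T) :
    Function.Injective (phiMap K S T p q) := by
  intro v w h
  apply Subtype.ext
  rw [← coe_phiMap hp hq v, h, coe_phiMap hp hq w]

theorem phiMap_surjective {S T : Set Q} {p q : Q} (hp : p ∈ S) (hq : q ∈ T) :
    Function.Surjective (phiMap K S T p q) := by
  intro w
  exact ⟨⟨w, by simp [convexSub_pos K hp]⟩, Subtype.ext (coe_phiMap hp hq _)⟩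

theorem phiMap_ne_zero {S T : Set Q} {p q : Q} (hp : p ∈ S) (hq : q ∈ T) :
    phiMap K S T p q ≠ 0 := by
  intro h
  have h1 := coe_phiMap (K := K) hp hq ⟨1, by simp [convexSub_pos K hp]⟩
  rw [h] at h1
  simp at h1

theorem phiMap_comp {R S T : Set Q} {p q r : Q} (hp : p ∈ R) (hq : q ∈ S) (hr : r ∈ T) :
    (phiMap K S T q r).comp (phiMap K R S p q) = phiMap K R T p r := by
  ext v
  simp [coe_phiMap hp hq, coe_phiMap hq hr, coe_phiMap hp hr]

theorem mem_of_convexSub_ne_zero {S : Set Q} {p : Q} {v : convexSub K S p} (hv : v ≠ 0) :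
    p ∈ S := by
  by_contra h
  have := subsingleton_convexSub (K := K) h
  exact hv (Subsingleton.elim _ _)

variable [Preorder Q] {S T : Set Q} {hS : S.OrdConnected} {hT : T.OrdConnected}

theorem mem_target_of_app_ne_zero (f : RepHom (convexRep K S hS) (convexRep K T hT)) {p q : Q}
    (hf : f.app p ≠ 0) (hqp : q ≤ p) (hq : q ∈ S) : q ∈ T := by
  by_contra hqT
  apply hf
  have hfq : f.app q = 0 :=
    LinearMap.ext fun _ => (subsingleton_convexSub (K := K) hqT).elim _ _
  have hp : p ∈ S := by
    by_contra hp
    apply hf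
    have : Subsingleton ((convexRep K S hS).V p) := subsingleton_convexSub (K := K) hp
    exact Subsingleton.elim _ _
  have hnat := f.natural hqp
  rw [hfq, LinearMap.comp_zero] at hnat
  ext v
  obtain ⟨w, rfl⟩ := phiMap_surjective (K := K) hq hp v
  exact (LinearMap.congr_fun hnat w).symm

theorem mem_source_of_app_ne_zero (f : RepHom (convexRep K S hS) (convexRep K T hT)) {p q : Q}
    (hf : f.app p ≠ 0) (hpq : p ≤ q) (hq : q ∈ T) : q ∈ S := by
  by_contra hqS
  apply hf
  have hfq : f.app q = 0 := by
    have : Subsingleton ((convexRep K S hS).V q) := subsingleton_convexSub (K := K) hqS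
    exact Subsingleton.elim _ _
  have hp : p ∈ T := by
    by_contra hp
    exact hf (LinearMap.ext fun _ => (subsingleton_convexSub (K := K) hp).elim _ _)
  have hnat := f.natural hpq
  rw [hfq, LinearMap.zero_comp] at hnat
  ext v
  refine phiMap_injective (K := K) hp hq ?_
  exact (LinearMap.congr_fun hnat v).trans (map_zero _).symm

/-- The morphism between convex representations that is the identity on `S ∩ T`, which must be
closed downwards in `S` and upwards in `T`. -/
noncomputable def convexHom (hS : S.OrdConnected) (hT : T.OrdConnected)
    (hdown : ∀ {p q}, p ≤ q → p ∈ S → q ∈ S → q ∈ T → p ∈ T)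
    (hup : ∀ {p q}, p ≤ q → p ∈ S → p ∈ T → q ∈ T → q ∈ S) :
    RepHom (convexRep K S hS) (convexRep K T hT) where
  app p := phiMap K S T p p
  natural {p q} hpq := by
    change (phiMap K T T p q).comp (phiMap K S T p p) =
      (phiMap K S T q q).comp (phiMap K S S p q)
    by_cases hpS : p ∈ S
    · by_cases hqT : q ∈ T
      · by_cases hpT : p ∈ T
        · have hqS := hup hpq hpS hpT hqT
          rw [phiMap_comp hpS hpT hqT, phiMap_comp hpS hqS hqT]
        · have hqS : q ∉ S := fun hqS => hpT (hdown hpq hpS hqS hqT)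
          rw [phiMap_neg K (S := S) (T := T) (p := p) (by tauto),
            phiMap_neg K (S := S) (T := T) (p := q) (by tauto)]
          simp
      · rw [phiMap_neg K (S := T) (T := T) (by tauto),
          phiMap_neg K (S := S) (T := T) (p := q) (by tauto)]
        simp
    · rw [phiMap_neg K (S := S) (T := T) (p := p) (by tauto),
        phiMap_neg K (S := S) (T := S) (by tauto)]
      simp

end Convex

/-- The finite values of `Λ_ε` form an interval of `{0, …, n}`. -/
theorem exists_lamFun_eq {n a b ε : ℕ} {p q : WithTop (Fin (n + 1))} {x : Fin (n + 1)}
    (hq : lamFun n a b ε q ≤ x) (hp : x ≤ lamFun n a b ε p) (hp' : lamFun n a b ε p ≠ ⊤) :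
    ∃ r, lamFun n a b ε r = x := by
  induction p using WithTop.recTopCoe with
  | top => exact absurd rfl hp'
  | coe p =>
  induction q using WithTop.recTopCoe with
  | top => exact absurd (top_le_iff.mp hq) (WithTop.coe_ne_top)
  | coe q =>
  obtain heq | hne := hp.eq_or_lt
  · exact ⟨p, heq.symm⟩
  rw [lamFun_coe] at hp hq hp' hne
  split_ifs at hp hq hp' hne with h1 h2
  · exact absurd rfl hp'
  · exact absurd rfl hp'
  · exact absurd (top_le_iff.mp hq) (WithTop.coe_ne_top)
  · rw [WithTop.coe_le_coe, Fin.le_def] at hq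
    rw [WithTop.coe_lt_coe, Fin.lt_def] at hne
    dsimp only at hq hne
    refine ⟨((⟨(x : ℕ) - ε / a, by omega⟩ : Fin (n + 1)) : WithTop (Fin (n + 1))), ?_⟩
    rw [lamFun_coe, if_neg]
    · congr 1
      apply Fin.ext
      dsimp only
      omega
    · intro h
      apply h1
      dsimp only at h
      have hle : n - (p : ℕ) ≤ n - ((x : ℕ) - ε / a) := by omega
      exact (Nat.add_le_add_right (Nat.mul_le_mul_left a hle) b).trans h

/-- Let `Λ = Λ_ε` be the maximal translation of height `ε` on
`P⁺ = {0, …, n} ∪ {∞}` and let `A`, `B` be convex representations of `{0, …, n}` with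
`AΛ ≠ 0`, `BΛ ≠ 0`.  If there is a nonzero morphism `A → B`, then there is a nonzero
morphism `AΛ → BΛ`. -/
theorem statement12 (n a b ε : ℕ) (ha : 0 < a) (hb : 0 < b) {K : Type*} [Field K]
    (x X y Y : Fin (n + 1)) (hxX : x ≤ X) (hyY : y ≤ Y)
    (hAΛ : ∃ p, ∃ v : ((intervalRep n K x X).shift (lamTrans n a b ε)).V p, v ≠ 0)
    (hBΛ : ∃ p, ∃ v : ((intervalRep n K y Y).shift (lamTrans n a b ε)).V p, v ≠ 0)
    (hhom : ∃ f : RepHom (intervalRep n K x X) (intervalRep n K y Y),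
        ∃ p, f.app p ≠ 0) :
    ∃ g : RepHom ((intervalRep n K x X).shift (lamTrans n a b ε))
        ((intervalRep n K y Y).shift (lamTrans n a b ε)),
      ∃ p, g.app p ≠ 0 := by
  obtain ⟨p, v, hv⟩ := hAΛ
  obtain ⟨q, w, hw⟩ := hBΛ
  obtain ⟨f, s, hf⟩ := hhom
  have hp : lamFun n a b ε p ∈ Set.Icc (x : WithTop (Fin (n + 1))) X :=
    mem_of_convexSub_ne_zero hv
  have hq : lamFun n a b ε q ∈ Set.Icc (y : WithTop (Fin (n + 1))) Y :=
    mem_of_convexSub_ne_zero hw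
  have hxX' := WithTop.coe_le_coe.mpr hxX
  have hyY' := WithTop.coe_le_coe.mpr hyY
  have hsS : s ∈ Set.Icc (x : WithTop (Fin (n + 1))) X := by
    by_contra h
    apply hf
    have : Subsingleton ((intervalRep n K x X).V s) := subsingleton_convexSub (K := K) h
    exact Subsingleton.elim _ _
  have hsT := mem_target_of_app_ne_zero f hf le_rfl hsS
  have hyx := (mem_target_of_app_ne_zero f hf hsS.1 ⟨le_rfl, hxX'⟩).1
  have hYX := (mem_source_of_app_ne_zero f hf hsT.2 ⟨hyY', le_rfl⟩).2
  have hxY := hsS.1.trans hsT.2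
  obtain ⟨r, hxr, hrY⟩ : ∃ r, x ≤ lamFun n a b ε r ∧ lamFun n a b ε r ≤ Y := by
    by_cases hqx : x ≤ lamFun n a b ε q
    · exact ⟨q, hqx, hq.2⟩
    · obtain ⟨r, hr⟩ := exists_lamFun_eq (not_le.mp hqx).le hp.1
        (hp.2.trans_lt (WithTop.coe_lt_top X)).ne
      exact ⟨r, hr.ge, hr.le.trans hxY⟩
  refine ⟨(convexHom Set.ordConnected_Icc Set.ordConnected_Icc
    (fun h h1 _ h3 => ⟨hyx.trans h1.1, h.trans h3.2⟩)
    (fun h h1 _ h3 => ⟨h1.1.trans h, h3.2.trans hYX⟩)).shift _, r, ?_⟩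
  exact phiMap_ne_zero ⟨hxr, hrY.trans hYX⟩ ⟨hyx.trans hxr, hrY⟩

end GPM
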